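/- Let V be an sl₂-Hodge structure of weight n polarized by Q, and let V = ⊕_{p+q=n} V♯^{p,q} with V♯^{p,q} = (e^Y F)^p ∩ (e^{−Y} F̄)^q be the associated polarized Hodge structure of weight n. Let C♯ ∈ GL(V) be the Weil operator of this Hodge structure, acting as (−1)^q on V♯^{p,q}, and let C ∈ GL(V) act as (−1)^j on the bigraded piece V^{i,j}. Then C♯ = w ∘ C, where w = e^X e^{−Y} e^X is the Weil element. -/

import Mathlib

/-!
For a polarized sl₂-Hodge structure of weight `n`, the Weil operator `C♯` of the
associated polarized Hodge structure `V = ⊕ V♯^{p,q}` (acting as `(−1)^q` on `V♯^{p,q}`)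
equals `w ∘ C`, where `w = e^X e^{−Y} e^X` is the Weil element and `C` acts as `(−1)^j`
on the bigraded piece `V^{i,j}`.
-/

/-- `c : ℂ` is a positive real number. -/
def posC (c : ℂ) : Prop := c.im = 0 ∧ 0 < c.re

/-- The exponential of a nilpotent endomorphism of a finite-dimensional space. -/
noncomputable def expEnd {V : Type*} [AddCommGroup V] [Module ℂ V] [FiniteDimensional ℂ V]
    (A : V →ₗ[ℂ] V) : V →ₗ[ℂ] V :=
  ∑ k ∈ Finset.range (Module.finrank ℂ V + 1), ((k.factorial : ℂ))⁻¹ • A ^ k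

/-- The Weil element `w = e^X e^{−Y} e^X`. -/
noncomputable def weil {V : Type*} [AddCommGroup V] [Module ℂ V] [FiniteDimensional ℂ V]
    (X Y : V →ₗ[ℂ] V) : V →ₗ[ℂ] V :=
  expEnd X ∘ₗ expEnd (-Y) ∘ₗ expEnd X

/-- The total Hodge filtration `F^p = ⊕_{i ≥ p, j} V^{i,j}` of a bigrading. -/
def totalF {V : Type*} [AddCommGroup V] [Module ℂ V]
    (Vb : ℤ → ℤ → Submodule ℂ V) (p : ℤ) : Submodule ℂ V :=
  ⨆ i : ℤ, ⨆ (_ : p ≤ i), ⨆ j : ℤ, Vb i j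

/-- The conjugate total Hodge filtration `F̄^q = ⊕_{j ≥ q, i} V^{i,j}` of a bigrading. -/
def totalFbar {V : Type*} [AddCommGroup V] [Module ℂ V]
    (Vb : ℤ → ℤ → Submodule ℂ V) (q : ℤ) : Submodule ℂ V :=
  ⨆ j : ℤ, ⨆ (_ : q ≤ j), ⨆ i : ℤ, Vb i j

/-- The subspace `V♯^{p, n−p} = (e^Y F)^p ∩ (e^{−Y} F̄)^{n−p}`. -/
noncomputable def Vsharp {V : Type*} [AddCommGroup V] [Module ℂ V] [FiniteDimensional ℂ V]
    (n : ℤ) (Y : V →ₗ[ℂ] V) (Vb : ℤ → ℤ → Submodule ℂ V) (p : ℤ) : Submodule ℂ V :=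
  Submodule.map (expEnd Y) (totalF Vb p) ⊓
    Submodule.map (expEnd (-Y)) (totalFbar Vb (n - p))

section Exponential

variable {V : Type*} [AddCommGroup V] [Module ℂ V] [FiniteDimensional ℂ V]

lemma pow_eq_zero_of_finrank_le {A : Module.End ℂ V} (hA : IsNilpotent A) {k : ℕ}
    (hk : Module.finrank ℂ V ≤ k) : A ^ k = 0 := by
  refine pow_eq_zero_of_le hk ?_
  have h := A.aeval_self_charpoly
  rwa [hA.charpoly_eq_X_pow_finrank, map_pow, Polynomial.aeval_X] at h

lemma expEnd_eq_sum {A : Module.End ℂ V} (hA : IsNilpotent A) {m : ℕ}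
    (hm : Module.finrank ℂ V ≤ m) :
    expEnd A = ∑ k ∈ Finset.range m, ((k.factorial : ℂ))⁻¹ • A ^ k := by
  have key : ∀ m, Module.finrank ℂ V ≤ m →
      ∑ k ∈ Finset.range m, ((k.factorial : ℂ))⁻¹ • A ^ k =
        ∑ k ∈ Finset.range (Module.finrank ℂ V), ((k.factorial : ℂ))⁻¹ • A ^ k := by
    intro m hm
    refine (Finset.sum_subset (Finset.range_mono hm) fun k _ hk => ?_).symm
    rw [pow_eq_zero_of_finrank_le hA (by simpa using hk), smul_zero]
  rw [key m hm, expEnd, key _ (Nat.le_succ _)]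

lemma expEnd_eq_exp [Module ℚ (Module.End ℂ V)] {A : Module.End ℂ V} (hA : IsNilpotent A) :
    expEnd A = IsNilpotent.exp A := by
  rw [IsNilpotent.exp_eq_sum (pow_eq_zero_of_finrank_le hA (Nat.le_succ _)), expEnd]
  refine Finset.sum_congr rfl fun k _ => ?_
  have h : (k.factorial : ℚ) ≠ 0 := by positivity
  have h' : (k.factorial : ℂ) ≠ 0 := by exact_mod_cast k.factorial_ne_zero
  rw [inv_smul_eq_iff₀ h', Nat.cast_smul_eq_nsmul, ← Nat.cast_smul_eq_nsmul ℚ,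
    smul_inv_smul₀ h]

lemma expEnd_add {A B : Module.End ℂ V} (h : Commute A B) (hA : IsNilpotent A)
    (hB : IsNilpotent B) : expEnd (A + B) = expEnd A * expEnd B := by
  let : Module ℚ (Module.End ℂ V) := Module.compHom _ (algebraMap ℚ ℂ)
  rw [expEnd_eq_exp (h.isNilpotent_add hA hB), expEnd_eq_exp hA, expEnd_eq_exp hB,
    IsNilpotent.exp_add_of_commute h hA hB]

lemma expEnd_zero : expEnd (0 : Module.End ℂ V) = 1 := by
  rw [expEnd, Finset.sum_range_succ']
  simp

lemma expEnd_add_smul {A : Module.End ℂ V} (hA : IsNilpotent A) (s t : ℂ) :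
    expEnd ((s + t) • A) = expEnd (s • A) * expEnd (t • A) := by
  rw [add_smul, expEnd_add (((Commute.refl A).smul_left s).smul_right t) (hA.smul s) (hA.smul t)]

lemma expEnd_mul_of_semiconj {A B g : Module.End ℂ V} (h : A * g = g * B) :
    expEnd A * g = g * expEnd B := by
  have hs : SemiconjBy g B A := h.symm
  simp only [expEnd, Finset.sum_mul, Finset.mul_sum, smul_mul_assoc, mul_smul_comm]
  exact Finset.sum_congr rfl fun k _ => by rw [(hs.pow_right k).eq]

lemma expEnd_apply_mem {A : Module.End ℂ V} {S : Submodule ℂ V} (h : ∀ v ∈ S, A v ∈ S) {v : V}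
    (hv : v ∈ S) : expEnd A v ∈ S := by
  rw [expEnd, LinearMap.sum_apply]
  refine S.sum_mem fun k hk => S.smul_mem _ ?_
  clear hk
  induction k with
  | zero => exact hv
  | succ k ih => rw [pow_succ']; exact h _ ih

/-- `e^A Z e^{-A} = Z + [A, Z] + [A, [A, Z]] / 2` when `ad(A)^3 Z = 0`. -/
lemma expEnd_mul_of_commutators {A Z B D : Module.End ℂ V} (hA : IsNilpotent A)
    (hZ : A * Z = Z * A + B) (hB : A * B = B * A + (2 : ℂ) • D) (hD : A * D = D * A) :
    expEnd A * Z = (Z + B + D) * expEnd A := by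
  set e : ℕ → Module.End ℂ V := fun k => ((k.factorial : ℂ))⁻¹ • A ^ k with he
  have hsucc : ∀ k, A * e k = ((k : ℂ) + 1) • e (k + 1) := by
    intro k
    have h1 : (k.factorial : ℂ) ≠ 0 := by exact_mod_cast k.factorial_ne_zero
    have h2 : (k : ℂ) + 1 ≠ 0 := by exact_mod_cast k.succ_ne_zero
    simp only [he, mul_smul_comm, ← pow_succ', smul_smul, Nat.factorial_succ]
    congr 1
    push_cast
    field_simp
  have e0 : e 0 = 1 := by simp [he]
  have e1 : e 1 = A := by simp [he]
  have step : ∀ k, e (k + 2) * Z = Z * e (k + 2) + B * e (k + 1) + D * e k := by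
    intro k
    induction k with
    | zero =>
      have h2 : e 2 = (2 : ℂ)⁻¹ • (A * A) := by simp [he, pow_two, Nat.factorial]
      have : A * A * Z = Z * (A * A) + (2 : ℂ) • (B * A) + (2 : ℂ) • D := by
        rw [mul_assoc, hZ, mul_add, hB, ← mul_assoc, hZ, two_smul ℂ (B * A)]
        noncomm_ring
      rw [zero_add, zero_add, h2, e1, e0, smul_mul_assoc, this]
      simp only [smul_add, smul_smul, mul_smul_comm, mul_one]
      norm_num
    | succ k ih =>
      have h3 : ((k + 2 : ℕ) : ℂ) + 1 ≠ 0 := by exact_mod_cast (k + 2).succ_ne_zero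
      have s0 := hsucc k
      have s1 := hsucc (k + 1)
      have s2 := hsucc (k + 2)
      have : ((k + 2 : ℕ) + 1 : ℂ) • (e (k + 3) * Z) =
          ((k + 2 : ℕ) + 1 : ℂ) • (Z * e (k + 3) + B * e (k + 2) + D * e (k + 1)) := by
        calc _ = A * (e (k + 2) * Z) := by rw [← smul_mul_assoc, ← s2, mul_assoc]
          _ = (A * Z) * e (k + 2) + (A * B) * e (k + 1) + (A * D) * e k := by
            rw [ih]; noncomm_ring
          _ = Z * (A * e (k + 2)) + B * e (k + 2) + B * (A * e (k + 1)) +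
              (2 : ℂ) • (D * e (k + 1)) + D * (A * e k) := by
            rw [hZ, hB, hD]
            simp only [add_mul, mul_assoc, smul_mul_assoc]
            abel
          _ = _ := by
            rw [s0, s1, s2]
            simp only [mul_smul_comm]
            push_cast
            module
      exact smul_right_injective _ h3 this
  set N := Module.finrank ℂ V
  have hN0 : expEnd A = ∑ k ∈ Finset.range N, e k := expEnd_eq_sum hA le_rfl
  have hN1 : expEnd A = (∑ k ∈ Finset.range N, e (k + 1)) + 1 := by
    rw [← e0, ← Finset.sum_range_succ']
    exact expEnd_eq_sum hA (Nat.le_succ _)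
  have hN2 : expEnd A = (∑ k ∈ Finset.range N, e (k + 2)) + A + 1 := by
    rw [← e0]
    nth_rw 2 [← e1]
    rw [← Finset.sum_range_succ' (fun k => e (k + 1)), ← Finset.sum_range_succ']
    exact expEnd_eq_sum hA (by omega)
  calc expEnd A * Z
      = (∑ k ∈ Finset.range N, e (k + 2) * Z) + A * Z + Z := by
        rw [hN2, add_mul, add_mul, Finset.sum_mul, one_mul]
    _ = Z * ((∑ k ∈ Finset.range N, e (k + 2)) + A + 1) +
        B * ((∑ k ∈ Finset.range N, e (k + 1)) + 1) + D * ∑ k ∈ Finset.range N, e k := by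
        simp only [step, Finset.sum_add_distrib, ← Finset.mul_sum, hZ, mul_add, mul_one]
        abel
    _ = _ := by rw [← hN0, ← hN1, ← hN2]; noncomm_ring

end Exponential

section Grading

variable {V : Type*} [AddCommGroup V] [Module ℂ V] {ι : Type*} [DecidableEq ι]
  {S : ι → Submodule ℂ V}

lemma DirectSum.IsInternal.linearMap_ext (h : DirectSum.IsInternal S) {f g : V →ₗ[ℂ] V}
    (hfg : ∀ i, ∀ u ∈ S i, f u = g u) : f = g := by
  have : (⊤ : Submodule ℂ V) ≤ LinearMap.eqLocus f g := by
    rw [← h.submodule_iSup_eq_top]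
    exact iSup_le fun i u hu => hfg i u hu
  exact LinearMap.ext fun v => this (Submodule.mem_top (x := v))

lemma DirectSum.IsInternal.exists_diagonal (h : DirectSum.IsInternal S) (c : ι → ℂ) :
    ∃ T : V →ₗ[ℂ] V, ∀ i, ∀ u ∈ S i, T u = c i • u := by
  let := h.chooseDecomposition
  refine ⟨DirectSum.toModule ℂ ι V (fun i => c i • (S i).subtype) ∘ₗ
    (DirectSum.decomposeLinearEquiv S).toLinearMap, fun i u hu => ?_⟩
  have := DirectSum.decomposeLinearEquiv_apply_coe (R := ℂ) (ℳ := S) i ⟨u, hu⟩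
  simp only at this
  simp [this]

/-- An eigenvector of a diagonal operator whose eigenvalue occurs in one degree only
lies in that degree. -/
lemma DirectSum.IsInternal.mem_of_apply_eq_smul (h : DirectSum.IsInternal S) {T : V →ₗ[ℂ] V}
    {c : ι → ℂ} (hT : ∀ i, ∀ u ∈ S i, T u = c i • u) {a : ι} (ha : ∀ i, c i = c a → i = a)
    {v : V} (hv : T v = c a • v) : v ∈ S a := by
  let := h.chooseDecomposition
  have key : ∀ v i, (DirectSum.decompose S (T v) i : V) = c i • (DirectSum.decompose S v i : V) := by
    intro v i
    induction v using DirectSum.Decomposition.inductionOn S with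
    | zero => simp
    | @homogeneous j u =>
      rw [hT j u u.2, DirectSum.decompose_smul]
      rcases eq_or_ne j i with rfl | hji
      · simp [DirectSum.decompose_coe, DirectSum.smul_apply]
      · simp [DirectSum.decompose_coe, DirectSum.smul_apply, DirectSum.of_eq_of_ne _ _ _ hji.symm]
    | add x y hx hy => simp [DirectSum.decompose_add, hx, hy]
  classical
  rw [← DirectSum.sum_support_decompose S v]
  refine (S a).sum_mem fun i hi => ?_
  have h0 : (DirectSum.decompose S v i : V) ≠ 0 := by simpa using hi
  have h1 := key v i
  rw [hv, DirectSum.decompose_smul] at h1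
  have h2 : c a = c i := smul_left_injective ℂ h0 (by simpa [DirectSum.smul_apply] using h1)
  rw [ha i h2.symm]
  exact (DirectSum.decompose S v a).2

lemma isNilpotent_of_shift [FiniteDimensional ℂ V] (h : DirectSum.IsInternal S)
    {A : Module.End ℂ V} {σ : ℕ → ι → ι} (hσ0 : ∀ i, σ 0 i = i)
    (hσ : ∀ i, Function.Injective fun m => σ m i)
    (hA : ∀ m i, ∀ u ∈ S (σ m i), A u ∈ S (σ (m + 1) i)) : IsNilpotent A := by
  have hfin : {i | S i ≠ ⊥}.Finite :=
    WellFoundedGT.finite_ne_bot_of_iSupIndep h.submodule_iSupIndep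
  refine Module.End.isNilpotent_iff_of_finite.mpr fun v => ?_
  have hv : v ∈ ⨆ i, S i := by rw [h.submodule_iSup_eq_top]; trivial
  suffices hle : ⨆ i, S i ≤ A.maxGenEigenspace 0 by
    simpa [Module.End.mem_maxGenEigenspace] using hle hv
  refine iSup_le fun i u hu => ?_
  obtain ⟨m, hm⟩ : ∃ m, S (σ m i) = ⊥ := by
    by_contra! hne
    exact Set.infinite_of_injective_forall_mem (hσ i) hne hfin
  have hpow : ∀ k, (A ^ k) u ∈ S (σ k i) := by
    intro k
    induction k with
    | zero => simpa [hσ0] using hu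
    | succ k ih => rw [pow_succ']; exact hA k i _ ih
  have := hpow m
  rw [hm, Submodule.mem_bot] at this
  exact (Module.End.mem_maxGenEigenspace _ _ _).2 ⟨m, by simpa using this⟩

end Grading

section Sl2

variable {V : Type*} [AddCommGroup V] [Module ℂ V] [FiniteDimensional ℂ V]
  {H X Y : Module.End ℂ V}

/-- The operator `e^{tX} e^{sY} e^{tX}`, which for `t s = -1` is a torus conjugate of the
Weil element. -/
noncomputable def weilFamily (X Y : Module.End ℂ V) (t s : ℂ) : Module.End ℂ V :=
  expEnd (t • X) * expEnd (s • Y) * expEnd (t • X)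

lemma weil_eq_weilFamily (X Y : Module.End ℂ V) : weil X Y = weilFamily X Y 1 (-1) := by
  simp only [weil, weilFamily, one_smul, neg_smul, mul_assoc]
  rfl

lemma expEnd_smul_X_mul_Y (hXn : IsNilpotent X) (hHX : H * X = X * H + (2 : ℂ) • X)
    (hXY : X * Y = Y * X + H) (t : ℂ) :
    expEnd (t • X) * Y = (Y + t • H + -t ^ 2 • X) * expEnd (t • X) := by
  refine expEnd_mul_of_commutators (hXn.smul t) ?_ ?_ ?_
  · simp only [smul_mul_assoc, mul_smul_comm, hXY, smul_add]
  · simp only [smul_mul_assoc, mul_smul_comm, hHX, smul_add]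
    module
  · simp only [smul_mul_assoc, mul_smul_comm, smul_comm t]

lemma expEnd_smul_X_mul_H (hXn : IsNilpotent X) (hHX : H * X = X * H + (2 : ℂ) • X) (t : ℂ) :
    expEnd (t • X) * H = (H + -(2 * t) • X) * expEnd (t • X) := by
  have := expEnd_mul_of_commutators (Z := H) (B := -(2 * t) • X) (D := 0) (hXn.smul t) ?_ ?_ ?_
  · simpa using this
  · simp only [smul_mul_assoc, mul_smul_comm, hHX, smul_add]
    module
  · simp only [smul_mul_assoc, mul_smul_comm, smul_zero, add_zero, smul_comm t]
  · simp

lemma expEnd_smul_X_mul_X (X : Module.End ℂ V) (t : ℂ) :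
    expEnd (t • X) * X = X * expEnd (t • X) :=
  expEnd_mul_of_semiconj (by simp only [smul_mul_assoc, mul_smul_comm])

lemma weilFamily_mul_Y (hXn : IsNilpotent X) (hYn : IsNilpotent Y)
    (hHX : H * X = X * H + (2 : ℂ) • X) (hHY : H * Y = Y * H + (-2 : ℂ) • Y)
    (hXY : X * Y = Y * X + H) {t s : ℂ} (hts : t * s = -1) :
    weilFamily X Y t s * Y = -t ^ 2 • (X * weilFamily X Y t s) := by
  have hYX : Y * X = X * Y + -H := by rw [hXY]; abel
  have hHY' : -H * Y = Y * -H + (2 : ℂ) • Y := by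
    rw [neg_mul, hHY, mul_neg]; module
  have hfX := expEnd_smul_X_mul_Y hYn hHY' hYX s
  have hfH := expEnd_smul_X_mul_H hYn hHY' s
  have hfY := expEnd_smul_X_mul_X Y s
  have heY := expEnd_smul_X_mul_Y hXn hHX hXY t
  have heX := expEnd_smul_X_mul_X X t
  have hmid : expEnd (s • Y) * (Y + t • H + -t ^ 2 • X) = -t ^ 2 • X * expEnd (s • Y) := by
    have hfH' : expEnd (s • Y) * H = (H + (2 * s) • Y) * expEnd (s • Y) := by
      rw [mul_neg] at hfH
      rw [← neg_inj, hfH, ← neg_mul (H + (2 * s) • Y)]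
      congr 1
      module
    rw [mul_add, mul_add, mul_smul_comm, mul_smul_comm, hfX, hfY, hfH',
      ← smul_mul_assoc, ← smul_mul_assoc, ← add_mul, ← add_mul]
    congr 1
    have h1 : t ^ 2 * s = -t := by linear_combination t * hts
    have h2 : t ^ 2 * s ^ 2 = 1 := by linear_combination (t * s - 1) * hts
    match_scalars
    · linear_combination 2 * hts + h2
    · linear_combination h1
    · ring
  rw [weilFamily, mul_assoc, heY, ← mul_assoc, mul_assoc (expEnd (t • X)), hmid, ← mul_assoc,
    mul_smul_comm, heX]
  simp only [smul_mul_assoc, mul_assoc]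

lemma weilFamily_mul_X (hXn : IsNilpotent X) (hYn : IsNilpotent Y)
    (hHX : H * X = X * H + (2 : ℂ) • X) (hHY : H * Y = Y * H + (-2 : ℂ) • Y)
    (hXY : X * Y = Y * X + H) {t s : ℂ} (hts : t * s = -1) :
    weilFamily X Y t s * X = -s ^ 2 • (Y * weilFamily X Y t s) := by
  have hYX : Y * X = X * Y + -H := by rw [hXY]; abel
  have hHY' : -H * Y = Y * -H + (2 : ℂ) • Y := by
    rw [neg_mul, hHY, mul_neg]; module
  have hfX := expEnd_smul_X_mul_Y hYn hHY' hYX s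
  have heX := expEnd_smul_X_mul_X X t
  have heH := expEnd_smul_X_mul_H hXn hHX t
  have heY := expEnd_smul_X_mul_Y hXn hHX hXY t
  have hmid : expEnd (t • X) * (X + s • -H + -s ^ 2 • Y) = -s ^ 2 • Y * expEnd (t • X) := by
    rw [mul_add, mul_add, mul_smul_comm, mul_smul_comm, mul_neg, heX, heY, heH,
      ← neg_mul (H + _), ← smul_mul_assoc, ← smul_mul_assoc, ← add_mul, ← add_mul]
    congr 1
    have h1 : t * s ^ 2 = -s := by linear_combination s * hts
    have h2 : t ^ 2 * s ^ 2 = 1 := by linear_combination (t * s - 1) * hts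
    match_scalars
    · linear_combination 2 * hts + h2
    · linear_combination -h1
    · ring
  rw [weilFamily, mul_assoc, heX, ← mul_assoc, mul_assoc (expEnd (t • X)), hfX, ← mul_assoc, hmid]
  simp only [smul_mul_assoc, mul_assoc]

lemma weilFamily_mul_H (hXn : IsNilpotent X) (hYn : IsNilpotent Y)
    (hHX : H * X = X * H + (2 : ℂ) • X) (hHY : H * Y = Y * H + (-2 : ℂ) • Y)
    (hXY : X * Y = Y * X + H) {t s : ℂ} (hts : t * s = -1) :
    weilFamily X Y t s * H = -(H * weilFamily X Y t s) := by
  have hH : H = X * Y - Y * X := by rw [hXY]; abel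
  have hX := weilFamily_mul_X hXn hYn hHX hHY hXY hts
  have hY := weilFamily_mul_Y hXn hYn hHX hHY hXY hts
  have h1 : s ^ 2 * t ^ 2 = 1 := by linear_combination (t * s - 1) * hts
  have hXY' : weilFamily X Y t s * (X * Y) = Y * X * weilFamily X Y t s := by
    rw [← mul_assoc, hX, smul_mul_assoc, mul_assoc, hY, mul_smul_comm, smul_smul, neg_mul_neg, h1,
      one_smul, mul_assoc]
  have hYX' : weilFamily X Y t s * (Y * X) = X * Y * weilFamily X Y t s := by
    rw [← mul_assoc, hY, smul_mul_assoc, mul_assoc, hX, mul_smul_comm, smul_smul, neg_mul_neg,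
      mul_comm, h1, one_smul, mul_assoc]
  rw [hH, mul_sub, hXY', hYX', sub_mul, neg_sub]

lemma weilFamily_mul_of_commute {D : Module.End ℂ V} (hX : X * D = D * X) (hY : Y * D = D * Y)
    (t s : ℂ) : weilFamily X Y t s * D = D * weilFamily X Y t s := by
  have he : expEnd (t • X) * D = D * expEnd (t • X) :=
    expEnd_mul_of_semiconj (by rw [smul_mul_assoc, hX, mul_smul_comm])
  have hf : expEnd (s • Y) * D = D * expEnd (s • Y) :=
    expEnd_mul_of_semiconj (by rw [smul_mul_assoc, hY, mul_smul_comm])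
  rw [weilFamily, mul_assoc, he, ← mul_assoc, mul_assoc (expEnd (t • X)), hf, ← mul_assoc, he]
  simp only [mul_assoc]

lemma expEnd_smul_mul_of_anticommute {A C : Module.End ℂ V} (h : C * A = -(A * C)) (t : ℂ) :
    C * expEnd (t • A) = expEnd (-t • A) * C :=
  (expEnd_mul_of_semiconj (by
    rw [smul_mul_assoc, mul_smul_comm, h, smul_neg, neg_smul])).symm

lemma weilFamily_mul_of_anticommute {C : Module.End ℂ V} (hX : C * X = -(X * C))
    (hY : C * Y = -(Y * C)) (t s : ℂ) :
    C * weilFamily X Y t s = weilFamily X Y (-t) (-s) * C := by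
  rw [weilFamily, ← mul_assoc, ← mul_assoc, expEnd_smul_mul_of_anticommute hX, mul_assoc _ C,
    expEnd_smul_mul_of_anticommute hY, mul_assoc, mul_assoc _ C,
    expEnd_smul_mul_of_anticommute hX, weilFamily]
  simp only [mul_assoc]

end Sl2

section Bigrading

variable {V : Type*} [AddCommGroup V] [Module ℂ V]
  {H X Y : Module.End ℂ V} {n : ℤ} {Vb : ℤ → ℤ → Submodule ℂ V}

lemma le_totalF {p i : ℤ} (j : ℤ) (h : p ≤ i) : Vb i j ≤ totalF Vb p :=
  le_iSup_of_le i (le_iSup_of_le h (le_iSup (fun j => Vb i j) j))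

lemma le_totalFbar {q j : ℤ} (i : ℤ) (h : q ≤ j) : Vb i j ≤ totalFbar Vb q :=
  le_iSup_of_le j (le_iSup_of_le h (le_iSup (fun i => Vb i j) i))

lemma apply_mem_totalF (hX : ∀ i j : ℤ, Submodule.map X (Vb i j) ≤ Vb (i + 1) (j + 1)) (p : ℤ) :
    ∀ v ∈ totalF Vb p, X v ∈ totalF Vb p := by
  refine show totalF Vb p ≤ (totalF Vb p).comap X from ?_
  refine iSup_le fun i => iSup_le fun hi => iSup_le fun j => ?_
  rw [← Submodule.map_le_iff_le_comap]
  exact (hX i j).trans (le_totalF _ (by omega))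

lemma apply_mem_totalFbar (hX : ∀ i j : ℤ, Submodule.map X (Vb i j) ≤ Vb (i + 1) (j + 1))
    (q : ℤ) : ∀ v ∈ totalFbar Vb q, X v ∈ totalFbar Vb q := by
  refine show totalFbar Vb q ≤ (totalFbar Vb q).comap X from ?_
  refine iSup_le fun j => iSup_le fun hj => iSup_le fun i => ?_
  rw [← Submodule.map_le_iff_le_comap]
  exact (hX i j).trans (le_totalFbar _ (by omega))

lemma weilFamily_apply_mem [FiniteDimensional ℂ V] (hXn : IsNilpotent X) (hYn : IsNilpotent Y)
    (hHX : H * X = X * H + (2 : ℂ) • X) (hHY : H * Y = Y * H + (-2 : ℂ) • Y)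
    (hXY : X * Y = Y * X + H)
    (hdec : DirectSum.IsInternal (fun ij : ℤ × ℤ => Vb ij.1 ij.2))
    (hH : ∀ i j : ℤ, ∀ v ∈ Vb i j, H v = ((i + j - n : ℤ) : ℂ) • v)
    (hX : ∀ i j : ℤ, Submodule.map X (Vb i j) ≤ Vb (i + 1) (j + 1))
    (hY : ∀ i j : ℤ, Submodule.map Y (Vb i j) ≤ Vb (i - 1) (j - 1))
    {t s : ℂ} (hts : t * s = -1) {i j : ℤ} {v : V} (hv : v ∈ Vb i j) :
    weilFamily X Y t s v ∈ Vb (n - j) (n - i) := by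
  obtain ⟨D, hD⟩ := hdec.exists_diagonal fun ij => ((ij.1 - ij.2 : ℤ) : ℂ)
  have hXD : X * D = D * X := hdec.linearMap_ext fun ij u hu => by
    have h1 := hD (ij.1 + 1, ij.2 + 1) _ (hX _ _ (Submodule.mem_map_of_mem hu))
    simp only [Module.End.mul_apply, h1, hD ij u hu, map_smul]
    congr 2; ring
  have hYD : Y * D = D * Y := hdec.linearMap_ext fun ij u hu => by
    have h1 := hD (ij.1 - 1, ij.2 - 1) _ (hY _ _ (Submodule.mem_map_of_mem hu))
    simp only [Module.End.mul_apply, h1, hD ij u hu, map_smul]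
    congr 2; ring
  have hWH := LinearMap.congr_fun (weilFamily_mul_H hXn hYn hHX hHY hXY hts) v
  have hWD := LinearMap.congr_fun (weilFamily_mul_of_commute hXD hYD t s) v
  simp only [Module.End.mul_apply, LinearMap.neg_apply, hH i j v hv, map_smul] at hWH
  simp only [Module.End.mul_apply, hD (i, j) v hv, map_smul] at hWD
  refine hdec.mem_of_apply_eq_smul (T := H + Complex.I • D) (a := (n - j, n - i))
    (c := fun ij => ((ij.1 + ij.2 - n : ℤ) : ℂ) + Complex.I * ((ij.1 - ij.2 : ℤ) : ℂ)) ?_ ?_ ?_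
  · intro ij u hu
    rw [LinearMap.add_apply, LinearMap.smul_apply, hH _ _ u hu, hD _ u hu, add_smul, mul_smul]
  · rintro ⟨a, b⟩ hab
    have hre := congrArg Complex.re hab
    have him := congrArg Complex.im hab
    simp at hre him
    norm_cast at hre him
    ext <;> dsimp only <;> omega
  · have hHW : H (weilFamily X Y t s v) = -((i + j - n : ℤ) : ℂ) • weilFamily X Y t s v := by
      rw [neg_smul, hWH, neg_neg]
    rw [LinearMap.add_apply, LinearMap.smul_apply, hHW, ← hWD, smul_smul, ← add_smul]
    congr 1
    push_cast
    ring

end Bigrading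

theorem sharp_weil_operator_eq_weil_comp
    {V : Type*} [AddCommGroup V] [Module ℂ V] [FiniteDimensional ℂ V]
    (n : ℤ) (H X Y : V →ₗ[ℂ] V)
    (hHX : H ∘ₗ X - X ∘ₗ H = (2 : ℂ) • X)
    (hHY : H ∘ₗ Y - Y ∘ₗ H = (-2 : ℂ) • Y)
    (hXY : X ∘ₗ Y - Y ∘ₗ X = H)
    (Vb : ℤ → ℤ → Submodule ℂ V)
    (hdec : DirectSum.IsInternal (fun ij : ℤ × ℤ => Vb ij.1 ij.2))
    (hH : ∀ i j : ℤ, ∀ v ∈ Vb i j, H v = ((i + j - n : ℤ) : ℂ) • v)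
    (hX : ∀ i j : ℤ, Submodule.map X (Vb i j) ≤ Vb (i + 1) (j + 1))
    (hY : ∀ i j : ℤ, Submodule.map Y (Vb i j) ≤ Vb (i - 1) (j - 1))
    (Q : V →ₗ[ℂ] V →ₛₗ[starRingEnd ℂ] ℂ)
    (hherm : ∀ v w : V, Q w v = starRingEnd ℂ (Q v w))
    (hnd : ∀ v : V, (∀ w : V, Q v w = 0) → v = 0)
    (hQH : ∀ v w : V, Q (H v) w = -Q v (H w))
    (hQX : ∀ v w : V, Q (X v) w = Q v (X w))
    (hQY : ∀ v w : V, Q (Y v) w = Q v (Y w))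
    (hpolorth : ∀ i j i' j' : ℤ, i + j = i' + j' → (i, j) ≠ (i', j') →
      ∀ v ∈ Vb i j, ∀ v' ∈ Vb i' j', Q v (weil X Y v') = 0)
    (hpolpos : ∀ i j : ℤ, ∀ v ∈ Vb i j, v ≠ 0 → posC ((-1 : ℂ) ^ j * Q v (weil X Y v))) :
    ∀ Cs C : V →ₗ[ℂ] V,
      -- `C♯` is the Weil operator of the Hodge structure `V = ⊕ V♯^{p,q}`
      (∀ p : ℤ, ∀ u ∈ Vsharp n Y Vb p, Cs u = ((-1 : ℂ) ^ (n - p)) • u) →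
      -- `C` acts as `(−1)^j` on `V^{i,j}`
      (∀ i j : ℤ, ∀ u ∈ Vb i j, C u = ((-1 : ℂ) ^ j) • u) →
      Cs = weil X Y ∘ₗ C := by
  intro Cs C hCs hC
  have hHX' : H * X = X * H + (2 : ℂ) • X := sub_eq_iff_eq_add'.1 hHX
  have hHY' : H * Y = Y * H + (-2 : ℂ) • Y := sub_eq_iff_eq_add'.1 hHY
  have hXY' : X * Y = Y * X + H := sub_eq_iff_eq_add'.1 hXY
  have hXn : IsNilpotent X := isNilpotent_of_shift hdec (σ := fun m ij => (ij.1 + m, ij.2 + m))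
    (by simp) (fun ij a b hab => by simpa using hab) fun m ij u hu => by
      have := hX _ _ (Submodule.mem_map_of_mem hu)
      simpa [add_assoc] using this
  have hYn : IsNilpotent Y := isNilpotent_of_shift hdec (σ := fun m ij => (ij.1 - m, ij.2 - m))
    (by simp) (fun ij a b hab => by simpa using hab) fun m ij u hu => by
      have := hY _ _ (Submodule.mem_map_of_mem hu)
      simpa [sub_sub] using this
  have hCX : C * X = -(X * C) := hdec.linearMap_ext fun ij u hu => by
    have h1 := hC _ _ _ (hX _ _ (Submodule.mem_map_of_mem hu))
    simp only [Module.End.mul_apply, LinearMap.neg_apply, h1, hC _ _ u hu, map_smul,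
      zpow_add_one₀ (neg_ne_zero.2 one_ne_zero : (-1 : ℂ) ≠ 0)]
    module
  have hCY : C * Y = -(Y * C) := hdec.linearMap_ext fun ij u hu => by
    have h1 := hC _ _ _ (hY _ _ (Submodule.mem_map_of_mem hu))
    simp only [Module.End.mul_apply, LinearMap.neg_apply, h1, hC _ _ u hu, map_smul,
      zpow_sub_one₀ (neg_ne_zero.2 one_ne_zero : (-1 : ℂ) ≠ 0), inv_neg, inv_one]
    module
  set e : ℂ → Module.End ℂ V := fun t => expEnd (t • X) with he
  set f : ℂ → Module.End ℂ V := fun t => expEnd (t • Y) with hf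
  have he_add : ∀ s t, e s * e t = e (s + t) := fun s t => (expEnd_add_smul hXn s t).symm
  have hf_add : ∀ s t, f s * f t = f (s + t) := fun s t => (expEnd_add_smul hYn s t).symm
  have he0 : e 0 = 1 := by simp [he, expEnd_zero]
  have hf0 : f 0 = 1 := by simp [hf, expEnd_zero]
  have hf1 : expEnd Y = f 1 := by simp [hf]
  have hfm1 : expEnd (-Y) = f (-1) := by simp [hf]
  have hweil : weil X Y = weilFamily X Y 1 (-1) := weil_eq_weilFamily X Y
  have hts : (1 : ℂ) * -1 = -1 := by norm_num
  have hts' : (-1 : ℂ) * 1 = -1 := by norm_num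
  -- `G` carries the bigrading by `i` to the decomposition into the `V♯^{p,n-p}`.
  set G : Module.End ℂ V := f 1 * e (-1 / 2) with hG
  have hGinv : G * (e (1 / 2) * f (-1)) = 1 := by
    rw [hG, mul_assoc, ← mul_assoc (e _), he_add, neg_div, neg_add_cancel, he0, one_mul, hf_add,
      add_neg_cancel, hf0]
  have hGmem : ∀ i j, ∀ v ∈ Vb i j, G v ∈ Vsharp n Y Vb i := by
    intro i j v hv
    refine ⟨?_, ?_⟩
    · rw [hf1]
      exact Submodule.mem_map_of_mem (expEnd_apply_mem
        (fun u hu => Submodule.smul_mem _ _ (apply_mem_totalF hX i u hu))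
        (le_totalF j le_rfl hv))
    · have hG' : G = f (-1) * (e (1 / 2) * weilFamily X Y (-1 / 2) 2) := by
        change _ = f (-1) * (e (1 / 2) * (e (-1 / 2) * f 2 * e (-1 / 2)))
        rw [← mul_assoc (e _), ← mul_assoc (e _), he_add, neg_div, add_neg_cancel, he0, one_mul,
          ← mul_assoc, hf_add, hG]
        norm_num
      rw [hfm1, hG']
      exact Submodule.mem_map_of_mem (expEnd_apply_mem
        (fun u hu => Submodule.smul_mem _ _ (apply_mem_totalFbar hX (n - i) u hu))
        (le_totalFbar (n - j) le_rfl
          (weilFamily_apply_mem hXn hYn hHX' hHY' hXY' hdec hH hX hY (by norm_num) hv)))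
  -- `w² = (-1)^H`, in the form relating `w` and `w⁻¹ = e^{-X} e^Y e^{-X}`.
  have hsq : ∀ i j, ∀ v ∈ Vb i j,
      (-1 : ℂ) ^ j • weilFamily X Y (-1) 1 v = (-1 : ℂ) ^ (n - i) • weilFamily X Y 1 (-1) v := by
    intro i j v hv
    have h1 := LinearMap.congr_fun (weilFamily_mul_of_anticommute hCX hCY 1 (-1)) v
    have h2 := hC _ _ _ (weilFamily_apply_mem hXn hYn hHX' hHY' hXY' hdec hH hX hY hts hv)
    simp only [Module.End.mul_apply, h2, hC i j v hv, map_smul, neg_neg] at h1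
    exact h1.symm
  have hwf : ∀ s, weilFamily X Y 1 (-1) * f s = e (-s) * weilFamily X Y 1 (-1) := fun s =>
    (expEnd_mul_of_semiconj (by
      rw [mul_smul_comm, weilFamily_mul_Y hXn hYn hHX' hHY' hXY' hts, smul_mul_assoc]
      module)).symm
  have hwe : ∀ s, weilFamily X Y 1 (-1) * e s = f (-s) * weilFamily X Y 1 (-1) := fun s =>
    (expEnd_mul_of_semiconj (by
      rw [mul_smul_comm, weilFamily_mul_X hXn hYn hHX' hHY' hXY' hts, smul_mul_assoc]
      module)).symm
  have hwe' : ∀ s, weilFamily X Y (-1) 1 * e s = f (-s) * weilFamily X Y (-1) 1 := fun s =>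
    (expEnd_mul_of_semiconj (by
      rw [mul_smul_comm, weilFamily_mul_X hXn hYn hHX' hHY' hXY' hts', smul_mul_assoc]
      module)).symm
  have hwfe : weilFamily X Y 1 (-1) * (f (-1) * e (1 / 2)) =
      e 1 * f (-(1 / 2)) * weilFamily X Y 1 (-1) := by
    rw [← mul_assoc, hwf, mul_assoc, hwe, ← mul_assoc, neg_neg]
  have hG' : e 1 * f (-(1 / 2)) * weilFamily X Y (-1) 1 = G := by
    rw [mul_assoc, ← hwe']
    change e 1 * (e (-1) * f 1 * e (-1) * e (1 / 2)) = _
    rw [mul_assoc _ (e (-1)) (e (1 / 2)), mul_assoc (e (-1)), ← mul_assoc, he_add, he_add,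
      add_neg_cancel, he0, one_mul, hG]
    norm_num
  have hCG : C * G = f (-1) * e (1 / 2) * C := by
    rw [hG, ← mul_assoc, expEnd_smul_mul_of_anticommute hCY, mul_assoc,
      expEnd_smul_mul_of_anticommute hCX, ← mul_assoc, neg_div, neg_neg]
  have hmain : Cs * G = weil X Y * C * G := hdec.linearMap_ext fun ij v hv => by
    rw [mul_assoc (weil X Y), hCG, hweil, ← mul_assoc (weilFamily X Y 1 (-1)), hwfe]
    simp only [Module.End.mul_apply, hCs _ _ (hGmem _ _ v hv), hC _ _ v hv, map_smul]
    have h1 := congrArg (e 1 * f (-(1 / 2))) (hsq _ _ v hv)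
    rw [map_smul, map_smul, ← Module.End.mul_apply, hG'] at h1
    have hn : ∀ k : ℤ, (-1 : ℂ) ^ k * (-1 : ℂ) ^ k = 1 := fun k => by
      rw [← mul_zpow]; norm_num
    have h2 := congrArg (fun x => ((-1 : ℂ) ^ (n - ij.1) * (-1 : ℂ) ^ ij.2) • x) h1
    simp only [smul_smul, mul_assoc, hn, mul_one] at h2
    rw [h2, mul_comm ((-1 : ℂ) ^ ij.2), ← mul_assoc, hn, one_mul]
    rfl
  calc Cs = Cs * G * (e (1 / 2) * f (-1)) := by rw [mul_assoc, hGinv, mul_one]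
    _ = weil X Y * C := by rw [hmain, mul_assoc, hGinv, mul_one]
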